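/- arXiv:quant-ph/0312003 — 4 statements merged into one kernel-verified Lean document; each statement's English description precedes it below -/
import Mathlib

section
/- Let ι be a finite linearly ordered type with cardinality B, let T > 0 and C > 0 be reals, and for each s ∈ ι let W(s) : ι → ℝ be a nonnegative function with ∑_{j∈ι} W(s)(j) ≤ T. Let m ≥ 1 be a natural number satisfying (T/C)·m·(m−1) + m ≤ B. Then there exist m pairwise distinct elements w_1, w_2, …, w_m ∈ ι such that for every pair of indices i < j in [1,m], W(w_i)(w_j) < C/m. -/
open Finset

/-- Markov's inequality for finite sums. -/
theorem card_filter_le_sum_div {ι : Type*} [Fintype ι] {f : ι → ℝ} {T c : ℝ}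
    (hf : ∀ j, 0 ≤ f j) (hsum : ∑ j, f j ≤ T) (hc : 0 < c) (L : Finset ι) :
    (#{j ∈ L | ¬ f j < c} : ℝ) ≤ T / c := by
  rw [le_div_iff₀ hc]
  calc (#{j ∈ L | ¬ f j < c} : ℝ) * c = ∑ _j ∈ {j ∈ L | ¬ f j < c}, c := by simp
    _ ≤ ∑ j ∈ L with ¬ f j < c, f j :=
        sum_le_sum fun j hj => not_lt.mp (mem_filter.mp hj).2
    _ ≤ ∑ j, f j := sum_le_univ_sum_of_nonneg hf
    _ ≤ T := hsum

/-- Greedy selection of `k` elements of `L`, each having weight less than `c` under all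
previously selected ones. -/
theorem exists_injective_forall_lt_weight_lt {ι : Type*} [Fintype ι] {W : ι → ι → ℝ} {T c : ℝ}
    (hW : ∀ s j, 0 ≤ W s j) (hsum : ∀ s, ∑ j, W s j ≤ T) (hT : 0 ≤ T) (hc : 0 < c)
    (k : ℕ) (L : Finset ι) (hL : T / c * ((k : ℝ) - 1) + k ≤ #L) :
    ∃ w : Fin k → ι, Function.Injective w ∧ (∀ i, w i ∈ L) ∧
      ∀ i j : Fin k, i < j → W (w i) (w j) < c := by
  classical
  induction k generalizing L with
  | zero => exact ⟨Fin.elim0, fun i => i.elim0, fun i => i.elim0, fun i => i.elim0⟩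
  | succ k ih =>
    push_cast at hL
    have hTc : 0 ≤ T / c := by positivity
    have hpos : 0 < #L := by
      have : (0 : ℝ) ≤ T / c * k := by positivity
      have : (0 : ℝ) < #L := by linarith [k.cast_nonneg (α := ℝ)]
      exact_mod_cast this
    obtain ⟨a, ha⟩ := card_pos.mp hpos
    have hsplit := card_filter_add_card_filter_not (s := L.erase a) (fun j => W a j < c)
    have hmarkov := card_filter_le_sum_div (hW a) (hsum a) hc (L.erase a)
    have herase := card_erase_add_one ha
    rw [← hsplit] at herase
    have hcard : (#{j ∈ L.erase a | W a j < c} : ℝ) + #{j ∈ L.erase a | ¬ W a j < c} + 1 = #L := by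
      exact_mod_cast herase
    obtain ⟨w, hinj, hmem, hlt⟩ := ih {j ∈ L.erase a | W a j < c} (by linarith)
    simp only [mem_filter, mem_erase] at hmem
    refine ⟨Fin.cons a w, ?_, ?_, ?_⟩
    · refine Fin.cons_injective_iff.mpr ⟨?_, hinj⟩
      rintro ⟨i, hi⟩
      exact (hmem i).1.1 hi
    · exact Fin.cases ha fun i => (hmem i).1.2
    · intro i j hij
      cases j using Fin.cases with
      | zero => exact absurd hij (Fin.not_lt_zero i)
      | succ j =>
        cases i using Fin.cases with
        | zero => exact (hmem j).2
        | succ i => exact hlt i j (Fin.succ_lt_succ_iff.mp hij)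

/-- Lightly weighted step search (Lemma `claim1`): if each of the `B` indices
carries total query weight at most `T`, and `m ≥ 1` satisfies
`(T/C)·m·(m−1) + m ≤ B`, then one can select `m` pairwise distinct indices
`w_1, …, w_m` such that `W (w i) (w j) < C/m` whenever `i < j`. -/
theorem lightly_weighted_step_search
    (ι : Type*) [Fintype ι] [LinearOrder ι] (B : ℕ) (hB : Fintype.card ι = B)
    (T C : ℝ) (hT : 0 < T) (hC : 0 < C)
    (W : ι → ι → ℝ) (hW : ∀ s j, 0 ≤ W s j) (hsum : ∀ s, ∑ j, W s j ≤ T)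
    (m : ℕ) (hm : 1 ≤ m)
    (hmB : (T / C) * (m : ℝ) * ((m : ℝ) - 1) + (m : ℝ) ≤ (B : ℝ)) :
    ∃ w : Fin m → ι, Function.Injective w ∧
      ∀ i j : Fin m, i < j → W (w i) (w j) < C / (m : ℝ) := by
  have hm0 : (0 : ℝ) < m := by exact_mod_cast hm
  obtain ⟨w, hinj, -, hlt⟩ := exists_injective_forall_lt_weight_lt hW hsum hT.le
    (div_pos hC hm0) m univ (by
      rw [card_univ, hB, div_div_eq_mul_div, mul_div_right_comm]
      exact hmB)
  exact ⟨w, hinj, hlt⟩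
end

section
/- Let n be a natural number and t > 0 a real. For each s ∈ Fin(2^n) let W(s) : Fin(2^n) → ℝ be a nonnegative function with ∑_j W(s)(j) ≤ t. Let m ≥ 1 be a natural number satisfying 288·t·m² − (288·t − 1)·m ≤ 2^n. Then there exist m pairwise distinct elements w_1, …, w_m ∈ Fin(2^n) such that for all indices i < j in [1,m], W(w_i)(w_j) < 1/(288·m). -/
open Finset

/-- Greedy selection: if every `s` forbids at most `B` elements and `k * (B + 1) < |α|`, then there
are `k + 1` distinct elements none of which is forbidden by an earlier one. -/
theorem exists_injective_forall_lt_notMem {α : Type*} [Fintype α] [DecidableEq α]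
    (F : α → Finset α) {B : ℝ} (hB : 0 ≤ B) (hF : ∀ s, ((F s).card : ℝ) ≤ B) (k : ℕ)
    (hk : (k : ℝ) * (B + 1) < Fintype.card α) :
    ∃ w : Fin (k + 1) → α, Function.Injective w ∧ ∀ i j, i < j → w j ∉ F (w i) := by
  induction k with
  | zero =>
    have hpos : 0 < Fintype.card α := by simpa using hk
    obtain ⟨a⟩ := Fintype.card_pos_iff.1 hpos
    refine ⟨fun _ => a, fun i j _ => ?_, fun i j hij => ?_⟩ <;> omega
  | succ k ih =>
    obtain ⟨w, hw, hwF⟩ := ih (lt_of_le_of_lt (by push_cast; nlinarith) hk)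
    obtain ⟨a, ha⟩ : ∃ a, a ∉ Finset.univ.biUnion fun i => insert (w i) (F (w i)) := by
      by_contra! h
      have hcard : (Fintype.card α : ℝ) ≤ ∑ i : Fin (k + 1), ((insert (w i) (F (w i))).card : ℝ) := by
        rw [← Finset.card_univ, ← Finset.eq_univ_of_forall h]
        exact_mod_cast Finset.card_biUnion_le
      have hle : ∑ i : Fin (k + 1), ((insert (w i) (F (w i))).card : ℝ) ≤
          ∑ _i : Fin (k + 1), (B + 1) := by
        refine Finset.sum_le_sum fun i _ => ?_
        have hins : ((insert (w i) (F (w i))).card : ℝ) ≤ (F (w i)).card + 1 := by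
          exact_mod_cast Finset.card_insert_le _ _
        linarith [hF (w i)]
      rw [Finset.sum_const, Finset.card_univ, Fintype.card_fin, nsmul_eq_mul] at hle
      linarith
    simp only [Finset.mem_biUnion, Finset.mem_univ, true_and, Finset.mem_insert, not_exists,
      not_or] at ha
    refine ⟨Fin.snoc w a, Fin.snoc_injective_iff.2 ⟨hw, ?_⟩, fun i j hij => ?_⟩
    · rintro ⟨i, hi⟩
      exact (ha i).1 hi.symm
    · induction i using Fin.lastCases with
      | last => exact absurd (Fin.le_last j) hij.not_ge
      | cast i =>
        induction j using Fin.lastCases with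
        | last => simpa using (ha i).2
        | cast j => simpa using hwF i j (by simpa using hij)

/-- Markov's inequality for finite sums. -/
theorem card_filter_le_mul_le_sum {α : Type*} [Fintype α] (f : α → ℝ) (hf : ∀ j, 0 ≤ f j) (c : ℝ) :
    ((Finset.univ.filter fun j => c ≤ f j).card : ℝ) * c ≤ ∑ j, f j := by
  rw [← nsmul_eq_mul]
  exact (Finset.card_nsmul_le_sum _ _ _ fun j hj => (Finset.mem_filter.1 hj).2).trans
    (Finset.sum_le_sum_of_subset_of_nonneg (Finset.filter_subset _ _) fun j _ _ => hf j)

/-- Lemma `claim2` (procedure LWSS2): if each of the `2^n` strings carries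
total query weight at most `t`, and `m ≥ 1` satisfies
`288·t·m² − (288·t − 1)·m ≤ 2^n`, then one can select `m` pairwise distinct
strings `w_1, …, w_m` such that `W (w i) (w j) < 1/(288·m)` whenever `i < j`. -/
theorem lwss2_selection
    (n : ℕ) (t : ℝ) (ht : 0 < t)
    (W : Fin (2 ^ n) → Fin (2 ^ n) → ℝ)
    (hW : ∀ s j, 0 ≤ W s j) (hsum : ∀ s, ∑ j, W s j ≤ t)
    (m : ℕ) (hm : 1 ≤ m)
    (hmB : 288 * t * (m : ℝ) ^ 2 - (288 * t - 1) * (m : ℝ) ≤ (2 : ℝ) ^ n) :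
    ∃ w : Fin m → Fin (2 ^ n), Function.Injective w ∧
      ∀ i j : Fin m, i < j → W (w i) (w j) < 1 / (288 * (m : ℝ)) := by
  obtain ⟨k, rfl⟩ : ∃ k, m = k + 1 := ⟨m - 1, by omega⟩
  have hpos : (0 : ℝ) < 288 * ((k + 1 : ℕ) : ℝ) := by positivity
  obtain ⟨w, hw, hwF⟩ := exists_injective_forall_lt_notMem
    (fun s => Finset.univ.filter fun j => 1 / (288 * ((k + 1 : ℕ) : ℝ)) ≤ W s j)
    (B := t * (288 * ((k + 1 : ℕ) : ℝ))) (by positivity)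
    (fun s => by
      have h := (card_filter_le_mul_le_sum (W s) (hW s)
        (1 / (288 * ((k + 1 : ℕ) : ℝ)))).trans (hsum s)
      rwa [mul_one_div, div_le_iff₀ hpos] at h)
    k (by
      rw [Fintype.card_fin]
      push_cast at hmB ⊢
      linarith)
  exact ⟨w, hw, fun i j hij => by simpa using hwF i j hij⟩
end

section
/- Let α be a finite type, T ≥ 1 a natural number, and P : (Fin T → α) → ℝ a nonnegative function with ∑_y P(y) = 1. Let b be a natural number and I_1, …, I_b ⊆ α pairwise disjoint subsets. Then ∑_{t=1}^{b} ( ∑ over all lists y : Fin T → α with y(j) ∉ I_t for every j of P(y) ) ≥ b − T. -/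
open Finset

/-- A list of `T` words meets at most `T` members of a pairwise disjoint family. -/
theorem card_filter_exists_mem_le {α ι : Type*} [DecidableEq α] [Fintype ι] {T : ℕ}
    (I : ι → Finset α) (hdisj : ∀ t t' : ι, t ≠ t' → Disjoint (I t) (I t'))
    (y : Fin T → α) :
    (Finset.univ.filter (fun t : ι => ¬ ∀ j, y j ∉ I t)).card ≤ T := by
  classical
  have hsub : Finset.univ.filter (fun t : ι => ¬ ∀ j, y j ∉ I t) ⊆
      Finset.univ.biUnion fun j => Finset.univ.filter fun t => y j ∈ I t := by
    intro t ht
    simpa using ht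
  refine (Finset.card_le_card hsub).trans ?_
  refine (Finset.card_biUnion_le_card_mul _ _ 1 fun j _ => ?_).trans (by simp)
  refine Finset.card_le_one.2 fun t ht t' ht' => ?_
  by_contra hne
  exact Finset.disjoint_left.1 (hdisj t t' hne)
    (Finset.mem_filter.1 ht).2 (Finset.mem_filter.1 ht').2

/-- Key estimate in the adversary lower bound (Proposition `inner-product`):
for a nonnegative distribution `P` on query lists `y : Fin T → α` summing to
`1`, and pairwise disjoint sets `I_1, …, I_b ⊆ α`, the sum over `t` of the
total weight of lists avoiding `I_t` is at least `b − T`. -/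
theorem sum_avoiding_weights_ge
    (α : Type*) [Fintype α] [DecidableEq α] (T : ℕ) (hT : 1 ≤ T)
    (P : (Fin T → α) → ℝ) (hP : ∀ y, 0 ≤ P y) (hsum : ∑ y, P y = 1)
    (b : ℕ) (I : Fin b → Finset α)
    (hdisj : ∀ t t' : Fin b, t ≠ t' → Disjoint (I t) (I t')) :
    (b : ℝ) - (T : ℝ) ≤
      ∑ t : Fin b,
        ∑ y ∈ Finset.univ.filter (fun y : Fin T → α => ∀ j, y j ∉ I t), P y := by
  have hcount (y : Fin T → α) : (b : ℝ) - T ≤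
      ((Finset.univ.filter (fun t : Fin b => ∀ j, y j ∉ I t)).card : ℝ) := by
    have hle := card_filter_exists_mem_le I hdisj y
    have hadd := Finset.card_filter_add_card_filter_not (s := (Finset.univ : Finset (Fin b)))
      (fun t => ∀ j, y j ∉ I t)
    rw [Finset.card_univ, Fintype.card_fin] at hadd
    rw [sub_le_iff_le_add]
    exact_mod_cast hadd.symm.le.trans (Nat.add_le_add_left hle _)
  calc (b : ℝ) - T = ∑ y, ((b : ℝ) - T) * P y := by
        rw [← Finset.mul_sum, hsum, mul_one]
    _ ≤ ∑ y, ((Finset.univ.filter (fun t : Fin b => ∀ j, y j ∉ I t)).card : ℝ) * P y :=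
        Finset.sum_le_sum fun y _ => mul_le_mul_of_nonneg_right (hcount y) (hP y)
    _ = _ := by
        simp_rw [Finset.sum_filter]
        rw [Finset.sum_comm]
        refine Finset.sum_congr rfl fun y _ => ?_
        rw [← Finset.sum_filter, Finset.sum_const, nsmul_eq_mul]
end

section
/- Let k ≥ 0, n, p ≥ 0, C > 0, T > 0 be reals, let M ≥ 1 be a real, and let l', l be reals with 0 ≤ l' ≤ l ≤ M. Then k + 2·l'·log₂M + 2 + l'·n + (M − l')·(n − p) + p·((M − l') − √(C·(M − l')/T)) ≤ M·n + 2·l·log₂M + k + 2 − p·√(C·(M − l)/T). -/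
/-- Length estimate for the encoding `E(s)` in Case 2 (`l > l'`) of the proof
of Proposition `submain`: the encoding length, written in terms of `l'`, is
bounded by the expression in the parameter `l ≥ l'`. -/
theorem case2_encoding_length_le
    (k n p C T M l' l : ℝ)
    (hk : 0 ≤ k) (hn : 0 ≤ n) (hp : 0 ≤ p) (hC : 0 < C) (hT : 0 < T)
    (hM : 1 ≤ M) (hl'0 : 0 ≤ l') (hl'l : l' ≤ l) (hlM : l ≤ M) :
    k + 2 * l' * Real.logb 2 M + 2 + l' * n + (M - l') * (n - p)
        + p * ((M - l') - Real.sqrt (C * (M - l') / T))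
      ≤ M * n + 2 * l * Real.logb 2 M + k + 2
        - p * Real.sqrt (C * (M - l) / T) := by
  have hlog : 0 ≤ Real.logb 2 M := Real.logb_nonneg one_lt_two hM
  have hlist : l' * Real.logb 2 M ≤ l * Real.logb 2 M :=
    mul_le_mul_of_nonneg_right hl'l hlog
  have hsqrt : p * Real.sqrt (C * (M - l) / T) ≤ p * Real.sqrt (C * (M - l') / T) := by
    gcongr
  linarith
end
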